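/- Let α > 1 and let P, Q be probability distributions on a finite set 𝒳 such that P(x) > 0 if and only if Q(x) > 0 for all x. Then TV(P ‖ Q) ≤ g_α^{-1}( D_{f_α}(P ‖ Q) ), where for s ≥ 0: g_α^{-1}(s) = sqrt( log(s+1) / (2(α−1)) ) if α < 2 and s < 2 − 2/α; g_α^{-1}(s) = (1/2) sqrt( (s+1)^{1/(α−1)} − 1 ) if α ≥ 2 and s < (1 + 4/α²)^{α−1} − 1; and g_α^{-1}(s) = max{ 1 − (s+1)^{1/(1−α)}, 1/α } otherwise. -/

import Mathlib

open Real

theorem aux_log (x : ℝ) (hx : 0 < x) : (x-1)*(5*x+1)/(2*x*(x+2)) ≤ Real.log x := by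
  let h : ℝ → ℝ := fun x => Real.log x - (x-1)*(5*x+1)/(2*x*(x+2))
  have hd : ∀ y, 0 < y → HasDerivAt h (4*(y-1)^3/(2*y*(y+2))^2) y := by
    intro y hy
    have h1 : HasDerivAt (fun x : ℝ => (x-1)*(5*x+1)) (1*(5*y+1)+(y-1)*(5*1)) y :=
      ((hasDerivAt_id y).sub_const 1).mul (((hasDerivAt_id y).const_mul 5).add_const 1)
    have h2 : HasDerivAt (fun x : ℝ => 2*x*(x+2)) ((2*1)*(y+2)+(2*y)*1) y :=
      ((hasDerivAt_id y).const_mul 2).mul ((hasDerivAt_id y).add_const 2)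
    have h3 := (Real.hasDerivAt_log hy.ne').sub (h1.div h2 (by positivity))
    refine h3.congr_deriv ?_
    have : y + 2 ≠ 0 := by positivity
    field_simp
    ring
  have h1 : h 1 = 0 := by simp [h]
  suffices 0 ≤ h x by simp only [h] at this; linarith
  rw [← h1]
  rcases le_total x 1 with hx1 | hx1
  · have : AntitoneOn h (Set.Icc x 1) := by
      apply antitoneOn_of_deriv_nonpos (convex_Icc _ _)
      · intro y hy
        exact (hd y (by linarith [hy.1])).continuousAt.continuousWithinAt
      · intro y hy
        rw [interior_Icc] at hy
        exact (hd y (by linarith [hy.1])).differentiableAt.differentiableWithinAt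
      · intro y hy
        rw [interior_Icc] at hy
        rw [(hd y (by linarith [hy.1])).deriv]
        apply div_nonpos_of_nonpos_of_nonneg _ (sq_nonneg _)
        have : 0 ≤ (1-y)^3 := pow_nonneg (by linarith [hy.2]) 3
        nlinarith
    exact this ⟨le_rfl, hx1⟩ ⟨hx1, le_rfl⟩ hx1
  · have : MonotoneOn h (Set.Icc 1 x) := by
      apply monotoneOn_of_deriv_nonneg (convex_Icc _ _)
      · intro y hy
        exact (hd y (by linarith [hy.1])).continuousAt.continuousWithinAt
      · intro y hy
        rw [interior_Icc] at hy
        exact (hd y (by linarith [hy.1])).differentiableAt.differentiableWithinAt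
      · intro y hy
        rw [interior_Icc] at hy
        rw [(hd y (by linarith [hy.1])).deriv]
        apply div_nonneg _ (sq_nonneg _)
        have : 0 ≤ (y-1)^3 := pow_nonneg (by linarith [hy.1]) 3
        nlinarith
    exact this ⟨le_rfl, hx1⟩ ⟨hx1, le_rfl⟩ hx1

theorem aux_pt (p q : ℝ) (hp : 0 < p) (hq : 0 < q) :
    (p-q)^2 ≤ ((4*q+2*p)/3) * (p * Real.log (p/q) - p + q) := by
  have h := aux_log (p/q) (by positivity)
  have e : (p/q-1)*(5*(p/q)+1)/(2*(p/q)*(p/q+2)) = (p-q)*(5*p+q)/(2*p*(p+2*q)) := by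
    field_simp
  rw [e, div_le_iff₀ (by positivity)] at h
  nlinarith

theorem aux_pinsker {X : Type*} (S : Finset X) (P Q : X → ℝ)
    (hP : ∀ x ∈ S, 0 < P x) (hQ : ∀ x ∈ S, 0 < Q x)
    (hP1 : ∑ x ∈ S, P x = 1) (hQ1 : ∑ x ∈ S, Q x = 1) :
    (∑ x ∈ S, |P x - Q x|)^2 ≤ 2 * ∑ x ∈ S, P x * Real.log (P x / Q x) := by
  have h := Finset.sum_sq_le_sum_mul_sum_of_sq_le_mul S (r := fun x => |P x - Q x|)
    (f := fun x => (4*Q x+2*P x)/3) (g := fun x => P x * Real.log (P x/Q x) - P x + Q x)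
    (fun x hx => by have := hP x hx; have := hQ x hx; positivity)
    (fun x hx => by
      have a := hP x hx
      have b := hQ x hx
      have c := aux_pt _ _ a b
      have d : 0 < (4*Q x+2*P x)/3 := by positivity
      by_contra hn
      push Not at hn
      nlinarith [sq_nonneg (P x - Q x)])
    (fun x hx => by
      rw [sq_abs]
      exact aux_pt _ _ (hP x hx) (hQ x hx))
  refine h.trans (le_of_eq ?_)
  rw [← Finset.sum_div, Finset.sum_add_distrib, Finset.sum_add_distrib, Finset.sum_sub_distrib,
    ← Finset.mul_sum, ← Finset.mul_sum, hP1, hQ1]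
  ring

theorem aux_renyi {X : Type*} (S : Finset X) (P Q : X → ℝ) (α : ℝ)
    (hP : ∀ x ∈ S, 0 < P x) (hQ : ∀ x ∈ S, 0 < Q x)
    (hP1 : ∑ x ∈ S, P x = 1) (c : ℝ) (hc : 0 < c)
    (hcs : c = ∑ x ∈ S, P x * (P x / Q x) ^ (α - 1)) :
    (α - 1) * ∑ x ∈ S, P x * Real.log (P x / Q x) ≤ Real.log c := by
  have : ∀ x ∈ S, (α - 1) * (P x * Real.log (P x / Q x)) ≤
      P x * (P x / Q x) ^ (α - 1) / c + P x * (Real.log c - 1) := by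
    intro x hx
    have a := hP x hx
    have b := hQ x hx
    have hy : 0 < (P x / Q x) ^ (α - 1) := by positivity
    have h := Real.log_le_sub_one_of_pos (div_pos hy hc)
    rw [Real.log_div hy.ne' hc.ne', Real.log_rpow (by positivity)] at h
    have := mul_le_mul_of_nonneg_left h a.le
    have e : P x * (P x / Q x) ^ (α - 1) / c = P x * ((P x / Q x) ^ (α - 1) / c) := by ring
    rw [e]
    nlinarith
  rw [Finset.mul_sum]
  refine (Finset.sum_le_sum this).trans (le_of_eq ?_)
  rw [Finset.sum_add_distrib, ← Finset.sum_div, ← Finset.sum_mul, ← hcs, hP1, div_self hc.ne']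
  ring

theorem aux_chi {X : Type*} (S : Finset X) (P Q : X → ℝ)
    (hQ : ∀ x ∈ S, 0 < Q x)
    (hP1 : ∑ x ∈ S, P x = 1) (hQ1 : ∑ x ∈ S, Q x = 1) :
    (∑ x ∈ S, |P x - Q x|)^2 ≤ ∑ x ∈ S, P x * (P x / Q x) - 1 := by
  have h := Finset.sum_sq_le_sum_mul_sum_of_sq_le_mul S (r := fun x => |P x - Q x|)
    (f := fun x => Q x) (g := fun x => P x * (P x/Q x) - 2 * P x + Q x)
    (fun x hx => (hQ x hx).le)
    (fun x hx => by
      have b := hQ x hx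
      have : P x * (P x/Q x) - 2 * P x + Q x = (P x - Q x)^2 / Q x := by field_simp; ring
      rw [this]; positivity)
    (fun x hx => by
      have b := hQ x hx
      rw [sq_abs]
      apply le_of_eq
      field_simp; ring)
  refine h.trans (le_of_eq ?_)
  rw [Finset.sum_add_distrib, Finset.sum_sub_distrib, ← Finset.mul_sum, hP1, hQ1]
  ring

theorem aux_num (α p q : ℝ) (hα : 1 < α) (hp : p ≤ 1) (hq : 0 < q) (ht : 1/α ≤ p - q) :
    (1 - (p - q)) ^ (1 - α) ≤ p ^ α * q ^ (1 - α) := by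
  have h0 : 0 < 1/α := by positivity
  have hp0 : 0 < p := by linarith
  set t := p - q with htd
  have h1t : 0 < 1 - t := by linarith
  have hB := one_add_mul_self_le_rpow_one_add (s := p - 1) (by linarith) (p := α/(α-1))
    (by rw [le_div_iff₀ (by linarith)]; linarith)
  have h2 : q / (1 - t) ≤ p ^ (α/(α-1)) := by
    have e : 1 + (p - 1) = p := by ring
    rw [e] at hB
    refine le_trans ?_ hB
    have hb : α/(α-1) * (1-t) ≤ 1 := by
      rw [div_mul_eq_mul_div, div_le_one (by linarith)]
      rw [div_le_iff₀ (by linarith)] at ht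
      nlinarith
    rw [div_le_iff₀ h1t]
    nlinarith
  have h3 := Real.rpow_le_rpow (by positivity) h2 (z := α - 1) (by linarith)
  rw [← Real.rpow_mul hp0.le, div_mul_cancel₀ _ (by linarith), Real.div_rpow hq.le h1t.le] at h3
  have e : 1 - α = -(α - 1) := by ring
  rw [e, Real.rpow_neg h1t.le, Real.rpow_neg hq.le]
  have hqq : 0 < q ^ (α - 1) := by positivity
  rw [← div_eq_mul_inv, le_div_iff₀ hqq, inv_mul_eq_div]
  exact h3

theorem aux_holder {X : Type*} (S : Finset X) (w f : X → ℝ) (r : ℝ) (hr : 1 ≤ r)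
    (hw : ∀ x, 0 ≤ w x) (hf : ∀ x, 0 ≤ f x) (hW : 0 < ∑ x ∈ S, w x) :
    (∑ x ∈ S, w x * f x) ^ r * (∑ x ∈ S, w x) ^ (1 - r) ≤ ∑ x ∈ S, w x * f x ^ r := by
  have h := Real.inner_le_weight_mul_Lp_of_nonneg S hr w f hw hf
  have hN : 0 ≤ ∑ x ∈ S, w x * f x ^ r :=
    Finset.sum_nonneg fun x _ => mul_nonneg (hw x) (Real.rpow_nonneg (hf x) _)
  have h2 := Real.rpow_le_rpow
    (Finset.sum_nonneg fun x _ => mul_nonneg (hw x) (hf x)) h (z := r) (by linarith)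
  rw [Real.mul_rpow (by positivity) (by positivity), ← Real.rpow_mul hW.le, ← Real.rpow_mul hN,
    inv_mul_cancel₀ (by linarith), Real.rpow_one] at h2
  have e : (1 - r⁻¹) * r = -(1 - r) := by field_simp; ring
  rw [e, Real.rpow_neg hW.le, inv_mul_eq_div, le_div_iff₀ (by positivity)] at h2
  exact h2

theorem stmt_13 {X : Type*} [Fintype X] (α : ℝ) (hα : 1 < α)
    (P Q : X → ℝ) (hP0 : ∀ x, 0 ≤ P x) (hQ0 : ∀ x, 0 ≤ Q x)
    (hP1 : ∑ x, P x = 1) (hQ1 : ∑ x, Q x = 1)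
    (hsupp : ∀ x, 0 < P x ↔ 0 < Q x)
    (s : ℝ)
    (hs : s = (∑ x ∈ Finset.univ.filter (fun x => 0 < Q x), Q x * (P x / Q x) ^ α) - 1) :
    (1 / 2) * (∑ x, |P x - Q x|) ≤
      (if α < 2 ∧ s < 2 - 2 / α then
          Real.sqrt (Real.log (s + 1) / (2 * (α - 1)))
        else if 2 ≤ α ∧ s < (1 + 4 / α ^ 2) ^ (α - 1) - 1 then
          (1 / 2) * Real.sqrt ((s + 1) ^ (1 / (α - 1)) - 1)
        else max (1 - (s + 1) ^ (1 / (1 - α))) (1 / α)) := by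
  classical
  set S := Finset.univ.filter (fun x => 0 < Q x) with hS
  have hQS : ∀ x ∈ S, 0 < Q x := fun x hx => by simpa [hS] using hx
  have hPS : ∀ x ∈ S, 0 < P x := fun x hx => (hsupp x).2 (hQS x hx)
  have hQn : ∀ x, x ∉ S → Q x = 0 := fun x hx => by
    have : ¬ 0 < Q x := by simpa [hS] using hx
    linarith [hQ0 x]
  have hPn : ∀ x, x ∉ S → P x = 0 := fun x hx => by
    have : ¬ 0 < P x := by rw [hsupp]; simpa [hS] using hx
    linarith [hP0 x]
  have hsub : S ⊆ Finset.univ := Finset.subset_univ S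
  have hP1' : ∑ x ∈ S, P x = 1 := by
    rw [← hP1]; exact Finset.sum_subset hsub fun x _ hx => hPn x hx
  have hQ1' : ∑ x ∈ S, Q x = 1 := by
    rw [← hQ1]; exact Finset.sum_subset hsub fun x _ hx => hQn x hx
  have hT : ∑ x, |P x - Q x| = ∑ x ∈ S, |P x - Q x| := by
    symm; exact Finset.sum_subset hsub fun x _ hx => by simp [hPn x hx, hQn x hx]
  have hsP : s + 1 = ∑ x ∈ S, P x * (P x / Q x) ^ (α - 1) := by
    rw [hs, sub_add_cancel]
    refine Finset.sum_congr rfl fun x hx => ?_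
    have a := hPS x hx
    have b := hQS x hx
    rw [Real.rpow_sub_one (by positivity)]
    field_simp
  have hne : S.Nonempty := by
    rw [Finset.nonempty_iff_ne_empty]; rintro h; rw [h] at hP1'; simp at hP1'
  have hs1 : 0 < s + 1 := by
    rw [hsP]
    refine Finset.sum_pos (fun x hx => ?_) hne
    have a := hPS x hx
    have b := hQS x hx
    positivity
  have hT0 : 0 ≤ ∑ x ∈ S, |P x - Q x| := Finset.sum_nonneg fun x _ => abs_nonneg _
  have hα1 : 0 < α - 1 := by linarith
  split_ifs with h1 h2
  · apply Real.le_sqrt_of_sq_le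
    rw [hT, le_div_iff₀ (by positivity)]
    have a := aux_pinsker S P Q hPS hQS hP1' hQ1'
    have b := aux_renyi S P Q α hPS hQS hP1' (s+1) hs1 hsP
    nlinarith
  · have hr : 1 ≤ α - 1 := by linarith [h2.1]
    have a := aux_chi S P Q hQS hP1' hQ1'
    have b := aux_holder S P (fun x => P x / Q x) (α - 1) hr hP0
      (fun x => div_nonneg (hP0 x) (hQ0 x)) (by rw [hP1']; norm_num)
    rw [hP1', Real.one_rpow, mul_one, ← hsP] at b
    have hK : 0 ≤ ∑ x ∈ S, P x * (P x / Q x) :=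
      Finset.sum_nonneg fun x _ => mul_nonneg (hP0 x) (div_nonneg (hP0 x) (hQ0 x))
    have c := Real.rpow_le_rpow (by positivity) b (z := 1/(α-1)) (by positivity)
    rw [← Real.rpow_mul hK, mul_one_div_cancel hα1.ne', Real.rpow_one] at c
    rw [hT]
    apply mul_le_mul_of_nonneg_left _ (by norm_num)
    apply Real.le_sqrt_of_sq_le
    linarith
  · rw [le_max_iff]
    by_cases ht : (1 / 2) * (∑ x, |P x - Q x|) ≤ 1 / α
    · exact Or.inr ht
    left
    push Not at ht
    rw [hT] at ht ⊢
    let A := S.filter (fun x => Q x < P x)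
    have hA : (1/2) * ∑ x ∈ S, |P x - Q x| = ∑ x ∈ A, P x - ∑ x ∈ A, Q x := by
      have e1 : ∑ x ∈ S, (|P x - Q x| + (P x - Q x)) = 2 * (∑ x ∈ A, P x - ∑ x ∈ A, Q x) := by
        rw [← Finset.sum_sub_distrib, Finset.mul_sum, Finset.sum_filter (s := S)]
        refine Finset.sum_congr rfl fun x _ => ?_
        split_ifs with h
        · rw [abs_of_pos (by linarith)]; ring
        · rw [abs_of_nonpos (by linarith)]; ring
      rw [Finset.sum_add_distrib, Finset.sum_sub_distrib, hP1', hQ1'] at e1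
      linarith
    have hAS : A ⊆ S := Finset.filter_subset _ _
    have hα0 : 0 < 1 / α := by positivity
    have hAne : A.Nonempty := by
      rw [Finset.nonempty_iff_ne_empty]; rintro h; rw [hA, h] at ht; simp at ht; linarith [inv_pos.2 (by linarith : 0 < α)]
    have hqp : 0 < ∑ x ∈ A, Q x := Finset.sum_pos (fun x hx => hQS x (hAS hx)) hAne
    have hp1 : ∑ x ∈ A, P x ≤ 1 := by
      rw [← hP1']; exact Finset.sum_le_sum_of_subset_of_nonneg hAS fun x _ _ => hP0 x
    have b := aux_holder A Q (fun x => P x / Q x) α hα.le hQ0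
      (fun x => div_nonneg (hP0 x) (hQ0 x)) hqp
    have e : ∑ x ∈ A, Q x * (P x / Q x) = ∑ x ∈ A, P x := by
      apply Finset.sum_congr rfl
      intro x hx
      have := hQS x (hAS hx)
      field_simp
    rw [e] at b
    rw [hA] at ht ⊢
    have c := aux_num α _ _ hα hp1 hqp ht.le
    have d : ∑ x ∈ A, Q x * (P x / Q x) ^ α ≤ s + 1 := by
      rw [hs, sub_add_cancel]
      exact Finset.sum_le_sum_of_subset_of_nonneg hAS fun x _ _ =>
        mul_nonneg (hQ0 x) (Real.rpow_nonneg (div_nonneg (hP0 x) (hQ0 x)) _)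
    set t := ∑ x ∈ A, P x - ∑ x ∈ A, Q x with htd
    have h1t : 0 < 1 - t := by linarith
    have f := c.trans (b.trans d)
    have g := Real.rpow_le_rpow_of_nonpos (by positivity) f
      (z := 1/(1-α)) (one_div_nonpos.2 (by linarith))
    rw [← Real.rpow_mul h1t.le, mul_one_div_cancel (by linarith), Real.rpow_one] at g
    linarith
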